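/- Hölder-in-time bound for a time non-local operator: assume S := sup_{(u,t) ∈ Simp_T} (t−u)^η ‖τ_{u,t}‖_{L(E,F)} < ∞ and S' := sup_{0 ≤ u < s < t ≤ T} (t−s)^{−(θ−κ)/2} (s−u)^η ‖τ_{u,t} − τ_{u,s}‖_{L(E,F)} < ∞. Then there is a constant C, depending only on θ, κ and T, such that for all 0 ≤ s ≤ t ≤ T and every continuous f : [0,T] → E one has ‖τ(f)(t) − τ(f)(s)‖_F ≤ C · |t−s|^{(θ−κ)/2} · (S + S') · ‖f‖. -/

import Mathlib

open MeasureTheory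

/-- The weakly singular kernel `u ↦ (t - u) ^ (b - 1)` is integrable on `[a, t]` for `b > 0`. -/
lemma intervalIntegrable_sub_rpow {b : ℝ} (hb : 0 < b) (a t : ℝ) :
    IntervalIntegrable (fun u => (t - u) ^ (b - 1)) volume a t := by
  have h := (intervalIntegral.intervalIntegrable_rpow' (a := t - a) (b := 0)
    (r := b - 1) (by linarith)).comp_sub_left t
  simpa using h

lemma integral_sub_rpow {b : ℝ} (hb : 0 < b) (a t : ℝ) :
    ∫ u in a..t, (t - u) ^ (b - 1) = (t - a) ^ b / b := by
  rw [intervalIntegral.integral_comp_sub_left (fun x => x ^ (b - 1)) t,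
    integral_rpow (Or.inl (by linarith))]
  simp [Real.zero_rpow hb.ne']

/-- A function dominated by `K * (t - u) ^ (b - 1)` on `(a, t)` is integrable there, and its
integral is at most `K * (t - a) ^ b / b`. -/
lemma intervalIntegrable_and_norm_integral_le_of_norm_le_sub_rpow
    {F : Type*} [NormedAddCommGroup F] [NormedSpace ℝ F]
    {b K a t : ℝ} (hb : 0 < b) (hat : a ≤ t) {g : ℝ → F}
    (hg : ContinuousOn g (Set.Ioo a t))
    (hle : ∀ u ∈ Set.Ioo a t, ‖g u‖ ≤ K * (t - u) ^ (b - 1)) :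
    IntervalIntegrable g volume a t ∧ ‖∫ u in a..t, g u‖ ≤ K * ((t - a) ^ b / b) := by
  have hK := (intervalIntegrable_sub_rpow hb a t).const_mul K
  have hne : ∀ᵐ u : ℝ, u ≠ t := Measure.ae_ne volume t
  have hae : ∀ᵐ u : ℝ, u ∈ Set.Ioc a t → ‖g u‖ ≤ K * (t - u) ^ (b - 1) := by
    filter_upwards [hne] with u hu hmem
    exact hle u ⟨hmem.1, lt_of_le_of_ne hmem.2 hu⟩
  refine ⟨hK.mono_fun' ?_ ?_, ?_⟩
  · rw [Set.uIoc_of_le hat, ← Measure.restrict_congr_set Ioo_ae_eq_Ioc]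
    exact hg.aestronglyMeasurable measurableSet_Ioo
  · rw [Set.uIoc_of_le hat]
    exact (ae_restrict_iff' measurableSet_Ioc).2 hae
  · refine (intervalIntegral.norm_integral_le_of_norm_le hat hae hK).trans_eq ?_
    rw [intervalIntegral.integral_const_mul, integral_sub_rpow hb]

/-- Solve `x ^ (1 - b) * y ≤ S` for `y`. -/
lemma le_mul_rpow_of_rpow_mul_le {x y S b : ℝ} (hx : 0 < x) (h : x ^ (1 - b) * y ≤ S) :
    y ≤ S * x ^ (b - 1) := by
  have hy : y = x ^ (1 - b) * y * x ^ (b - 1) := by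
    rw [mul_right_comm, ← Real.rpow_add hx]
    simp
  rw [hy]
  gcongr

/-- **Hölder-in-time bound for a time non-local operator.**
Let `E, F` be real Banach spaces, `T > 0`, `κ > 0`, `θ ∈ (κ, 2+κ)`, and
`η := 1 - (θ-κ)/2 ∈ (0,1)`.  There is a constant `C > 0`, depending only on `θ, κ, T`,
such that: for every `τ : Simp_T → L(E,F)` continuous in operator norm with
`S := sup_{(u,t) ∈ Simp_T} (t-u)^η ‖τ_{u,t}‖ < ∞` and
`S' := sup_{0 ≤ u < s < t ≤ T} (t-s)^{-(θ-κ)/2}(s-u)^η ‖τ_{u,t} - τ_{u,s}‖ < ∞`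
(formalized: `S`, `S'` are upper bounds), for all `0 ≤ s ≤ t ≤ T` and every continuous
`f : [0,T] → E` one has
`‖τ(f)(t) - τ(f)(s)‖_F ≤ C · |t-s|^{(θ-κ)/2} · (S + S') · ‖f‖_∞`,
where `τ(f)(r) = ∫₀ʳ τ_{u,r}(f(u)) du`. -/
theorem stmt5
    {E F : Type*} [NormedAddCommGroup E] [NormedSpace ℝ E]
    [NormedAddCommGroup F] [NormedSpace ℝ F] [CompleteSpace F]
    (T κ θ : ℝ) (hT : 0 < T) (hκ : 0 < κ) (hθκ : κ < θ) (hθ : θ < 2 + κ) :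
    ∃ C : ℝ, 0 < C ∧
      ∀ τ : ℝ → ℝ → E →L[ℝ] F,
        ContinuousOn (fun p : ℝ × ℝ => τ p.1 p.2)
            {p : ℝ × ℝ | 0 ≤ p.1 ∧ p.1 < p.2 ∧ p.2 ≤ T} →
        ∀ S S' : ℝ,
          (∀ u t : ℝ, 0 ≤ u → u < t → t ≤ T →
            (t - u) ^ (1 - (θ - κ) / 2) * ‖τ u t‖ ≤ S) →
          (∀ u s t : ℝ, 0 ≤ u → u < s → s < t → t ≤ T →
            (t - s) ^ (-((θ - κ) / 2)) * (s - u) ^ (1 - (θ - κ) / 2) *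
              ‖τ u t - τ u s‖ ≤ S') →
          ∀ s t : ℝ, 0 ≤ s → s ≤ t → t ≤ T →
            ∀ f : ℝ → E, ContinuousOn f (Set.Icc 0 T) →
              ‖(∫ u in (0 : ℝ)..t, τ u t (f u)) - ∫ u in (0 : ℝ)..s, τ u s (f u)‖ ≤
                C * |t - s| ^ ((θ - κ) / 2) * (S + S') *
                  ⨆ z : Set.Icc (0 : ℝ) T, ‖f (z : ℝ)‖ := by
  set b : ℝ := (θ - κ) / 2 with hb_def
  have hb : 0 < b := by rw [hb_def]; linarith
  have hTb : 0 < T ^ b := Real.rpow_pos_of_pos hT b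
  refine ⟨(1 + T ^ b) / b, by positivity, ?_⟩
  intro τ hτ S S' hS hS' s t hs hst htT f hf
  rcases hst.eq_or_lt with rfl | hst
  · simp [Real.zero_rpow hb.ne']
  set M : ℝ := ⨆ z : Set.Icc (0 : ℝ) T, ‖f (z : ℝ)‖
  have hM : ∀ u ∈ Set.Icc (0 : ℝ) T, ‖f u‖ ≤ M := by
    intro u hu
    have hbdd : BddAbove (Set.range fun z : Set.Icc (0 : ℝ) T => ‖f (z : ℝ)‖) := by
      have := (isCompact_Icc.image_of_continuousOn hf.norm).bddAbove
      rwa [Set.image_eq_range] at this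
    exact le_ciSup hbdd ⟨u, hu⟩
  have hM0 : 0 ≤ M := Real.iSup_nonneg fun _ => norm_nonneg _
  have hS0 : 0 ≤ S :=
    (mul_nonneg (Real.rpow_nonneg (by linarith) _) (norm_nonneg _)).trans
      (hS 0 T le_rfl hT le_rfl)
  have hS'0 : 0 ≤ S' :=
    (mul_nonneg (mul_nonneg (Real.rpow_nonneg (by linarith) _) (Real.rpow_nonneg (by linarith) _))
      (norm_nonneg _)).trans (hS' 0 (T / 2) T le_rfl (by linarith) (by linarith) le_rfl)
  have hcont : ∀ r a c : ℝ, 0 ≤ a → c ≤ r → r ≤ T →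
      ContinuousOn (fun u => τ u r (f u)) (Set.Ioo a c) := by
    intro r a c ha hc hr
    have hτr : ContinuousOn (fun u => τ u r) (Set.Ioo a c) :=
      hτ.comp (f := fun u : ℝ => (u, r)) (by fun_prop)
        fun u hu => ⟨ha.trans hu.1.le, hu.2.trans_le hc, hr⟩
    exact hτr.clm_apply (hf.mono fun u hu =>
      ⟨ha.trans hu.1.le, hu.2.le.trans (hc.trans hr)⟩)
  have hbound : ∀ r a : ℝ, 0 ≤ a → r ≤ T → ∀ u ∈ Set.Ioo a r,
      ‖τ u r (f u)‖ ≤ S * M * (r - u) ^ (b - 1) := by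
    intro r a ha hr u hu
    have hu0 : 0 ≤ u := ha.trans hu.1.le
    calc ‖τ u r (f u)‖ ≤ ‖τ u r‖ * ‖f u‖ := (τ u r).le_opNorm _
      _ ≤ S * (r - u) ^ (b - 1) * M :=
        mul_le_mul (le_mul_rpow_of_rpow_mul_le (sub_pos.2 hu.2) (hS u r hu0 hu.2 hr))
          (hM u ⟨hu0, hu.2.le.trans hr⟩) (norm_nonneg _)
          (mul_nonneg hS0 (Real.rpow_nonneg (sub_pos.2 hu.2).le _))
      _ = S * M * (r - u) ^ (b - 1) := by ring
  have hdiff : ∀ u ∈ Set.Ioo 0 s,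
      ‖τ u t (f u) - τ u s (f u)‖ ≤ S' * (t - s) ^ b * M * (s - u) ^ (b - 1) := by
    intro u hu
    have h := hS' u s t hu.1.le hu.2 hst htT
    have hts : 0 < t - s := sub_pos.2 hst
    have hop : ‖τ u t - τ u s‖ ≤ S' * (t - s) ^ b * (s - u) ^ (b - 1) := by
      refine le_mul_rpow_of_rpow_mul_le (sub_pos.2 hu.2) ?_
      rwa [mul_assoc, Real.rpow_neg hts.le, inv_mul_le_iff₀ (Real.rpow_pos_of_pos hts b),
        mul_comm _ S'] at h
    calc ‖τ u t (f u) - τ u s (f u)‖ ≤ ‖τ u t - τ u s‖ * ‖f u‖ := (τ u t - τ u s).le_opNorm _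
      _ ≤ S' * (t - s) ^ b * (s - u) ^ (b - 1) * M :=
        mul_le_mul hop (hM u ⟨hu.1.le, by linarith [hu.2]⟩) (norm_nonneg _)
          ((norm_nonneg _).trans hop)
      _ = S' * (t - s) ^ b * M * (s - u) ^ (b - 1) := by ring
  have hint_t := (intervalIntegrable_and_norm_integral_le_of_norm_le_sub_rpow hb
    (hs.trans hst.le) (hcont t 0 t le_rfl le_rfl htT) (hbound t 0 le_rfl htT)).1
  have hint_s := (intervalIntegrable_and_norm_integral_le_of_norm_le_sub_rpow hb
    hs (hcont s 0 s le_rfl le_rfl (by linarith)) (hbound s 0 le_rfl (by linarith))).1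
  obtain ⟨hint_st, hnorm_st⟩ := intervalIntegrable_and_norm_integral_le_of_norm_le_sub_rpow hb
    hst.le (hcont t s t hs le_rfl htT) (hbound t s hs htT)
  have hnorm_diff := (intervalIntegrable_and_norm_integral_le_of_norm_le_sub_rpow hb hs
    ((hcont t 0 s le_rfl hst.le htT).sub (hcont s 0 s le_rfl le_rfl (by linarith))) hdiff).2
  have hint_t0 : IntervalIntegrable (fun u => τ u t (f u)) volume 0 s :=
    hint_t.trans hint_st.symm
  have hsplit : (∫ u in (0 : ℝ)..t, τ u t (f u)) - ∫ u in (0 : ℝ)..s, τ u s (f u) =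
      (∫ u in (0 : ℝ)..s, (τ u t (f u) - τ u s (f u))) + ∫ u in s..t, τ u t (f u) := by
    rw [intervalIntegral.integral_sub hint_t0 hint_s,
      ← intervalIntegral.integral_add_adjacent_intervals hint_t0 hint_st]
    abel
  have hts : 0 ≤ (t - s) ^ b := Real.rpow_nonneg (sub_pos.2 hst).le b
  have hsT : s ^ b ≤ T ^ b := Real.rpow_le_rpow hs (by linarith) hb.le
  rw [hsplit, abs_of_pos (sub_pos.2 hst)]
  calc _ ≤ S' * (t - s) ^ b * M * ((s - 0) ^ b / b) + S * M * ((t - s) ^ b / b) :=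
        (norm_add_le _ _).trans (add_le_add hnorm_diff hnorm_st)
    _ ≤ S' * (t - s) ^ b * M * ((1 + T ^ b) / b) + S * M * ((1 + T ^ b) * (t - s) ^ b / b) := by
        rw [sub_zero]
        gcongr
        · linarith
        · nlinarith
    _ = (1 + T ^ b) / b * (t - s) ^ b * (S + S') * M := by ring
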